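/- Let K and L be n×n symmetric matrices over the field ℚ(μ) of rational functions in one variable over ℚ. If K and L have the same characteristic polynomial, i.e. det(tI − K) = det(tI − L) as polynomials in t over ℚ(μ), then K and L are similar over ℚ(μ): there exists an invertible n×n matrix M over ℚ(μ) with M⁻¹KM = L. -/

import Mathlib

open Polynomial

theorem RatFunc.eq_zero_of_sum_sq_eq_zero {ι : Type*} [Fintype ι] (v : ι → RatFunc ℚ)
    (h : ∑ i, v i * v i = 0) (i : ι) : v i = 0 := by
  obtain ⟨b, hb⟩ := IsLocalization.exist_integer_multiples_of_finite (nonZeroDivisors ℚ[X]) v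
  choose q hq using hb
  have hb0 : algebraMap ℚ[X] (RatFunc ℚ) b ≠ 0 := by simp
  have hsum : ∑ j, q j * q j = 0 := by
    apply RatFunc.algebraMap_injective ℚ
    rw [map_sum, map_zero, ← mul_zero (algebraMap ℚ[X] (RatFunc ℚ) b ^ 2), ← h, Finset.mul_sum]
    refine Finset.sum_congr rfl fun j _ ↦ ?_
    rw [map_mul, hq, Algebra.smul_def]
    ring
  have hqi : q i = 0 := by
    refine Polynomial.funext fun r ↦ ?_
    have hr := congrArg (Polynomial.eval r) hsum
    simp only [Polynomial.eval_finsetSum, Polynomial.eval_mul, Polynomial.eval_zero] at hr ⊢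
    rw [Finset.sum_eq_zero_iff_of_nonneg fun j _ ↦ mul_self_nonneg _] at hr
    exact mul_self_eq_zero.mp (hr i (Finset.mem_univ i))
  have := hq i
  rw [hqi, map_zero, Algebra.smul_def] at this
  exact (mul_eq_zero.mp this.symm).resolve_left hb0

theorem Matrix.IsSymm.aeval {n R : Type*} [Fintype n] [DecidableEq n] [CommRing R]
    {A : Matrix n n R} (hA : A.IsSymm) (p : R[X]) : (Polynomial.aeval A p).IsSymm := by
  induction p using Polynomial.induction_on' with
  | add p q hp hq => rw [map_add]; exact hp.add hq
  | monomial k a =>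
    rw [aeval_monomial, ← Algebra.smul_def]
    exact (hA.pow k).smul a

theorem Matrix.IsSymm.squarefree_minpoly_ratFunc {n : Type*} [Fintype n] [DecidableEq n]
    {A : Matrix n n (RatFunc ℚ)} (hA : A.IsSymm) : Squarefree (minpoly (RatFunc ℚ) A) := by
  have hm : minpoly (RatFunc ℚ) A ≠ 0 := minpoly.ne_zero (Algebra.IsIntegral.isIntegral A)
  rintro p ⟨q, hq⟩
  have hsq : Polynomial.aeval A (p * q) * Polynomial.aeval A (p * q) = 0 := by
    rw [← map_mul, show p * q * (p * q) = minpoly (RatFunc ℚ) A * q by rw [hq]; ring, map_mul,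
      minpoly.aeval, zero_mul]
  have hz : Polynomial.aeval A (p * q) = 0 := by
    have hS := hA.aeval (p * q)
    generalize Polynomial.aeval A (p * q) = B at hsq hS
    ext i j
    refine RatFunc.eq_zero_of_sum_sq_eq_zero (fun k ↦ B k j) ?_ i
    have := congrFun (congrFun hsq j) j
    rw [Matrix.mul_apply] at this
    simpa [hS.apply] using this
  have hdvd := minpoly.dvd _ _ hz
  rw [hq, mul_assoc] at hdvd
  refine isUnit_of_dvd_one <| (mul_dvd_mul_iff_right (c := p * q) ?_).mp (by rwa [one_mul])
  rintro h0
  exact hm (by rw [hq, mul_assoc, h0, mul_zero])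

theorem Irreducible.dvd_minpoly_of_dvd_charpoly {F V : Type*} [Field F] [AddCommGroup V]
    [Module F V] [FiniteDimensional F V] (f : Module.End F V) {p : F[X]} (hp : Irreducible p)
    (h : p ∣ f.charpoly) : p ∣ minpoly F f := by
  by_contra hn
  obtain ⟨a, b, hab⟩ := (hp.coprime_iff_not_dvd).mpr hn
  obtain ⟨α, hα⟩ := IsAlgClosed.exists_aeval_eq_zero (AlgebraicClosure F) p
    (degree_pos_of_irreducible hp).ne'
  have hev : Module.End.HasEigenvalue (f.baseChange (AlgebraicClosure F)) α := by
    rw [Module.End.hasEigenvalue_iff_isRoot_charpoly, LinearMap.charpoly_baseChange, IsRoot,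
      eval_map_algebraMap]
    obtain ⟨c, hc⟩ := h
    rw [hc, map_mul, hα, zero_mul]
  have hm : Polynomial.aeval α (minpoly F f) = 0 := by
    rw [← eval_map_algebraMap]
    refine (Module.End.isRoot_of_hasEigenvalue hev).dvd (minpoly.dvd _ _ ?_)
    rw [aeval_map_algebraMap]
    change Polynomial.aeval (Module.End.baseChangeHom F (AlgebraicClosure F) V f) _ = 0
    rw [aeval_algHom_apply, minpoly.aeval, map_zero]
  simpa [hα, hm] using congrArg (Polynomial.aeval α) hab

theorem aeval_lsmul_X {F M : Type*} [Field F] [AddCommGroup M] [Module F M] [Module F[X] M]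
    [IsScalarTower F F[X] M] (p : F[X]) (x : M) :
    Polynomial.aeval (Algebra.lsmul F F M (X : F[X])) p x = p • x := by
  rw [aeval_algHom_apply, aeval_X_left_apply, Algebra.lsmul_coe]

theorem torsionOf_eq_span_of_irreducible {F M : Type*} [Field F] [AddCommGroup M] [Module F[X] M]
    {p : F[X]} (hp : Irreducible p) {x : M} (hx : x ≠ 0) (h : p • x = 0) :
    Ideal.torsionOf F[X] M x = Ideal.span {p} := by
  refine ((PrincipalIdealRing.isMaximal_of_irreducible hp).eq_of_le ?_ ?_).symm
  · simpa [Ideal.torsionOf_eq_top_iff] using hx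
  · simpa [Ideal.span_singleton_le_iff_mem] using h

section
variable {F M N : Type*} [Field F]
  [AddCommGroup M] [Module F M] [Module F[X] M] [IsScalarTower F F[X] M] [Module.Finite F M]
  [AddCommGroup N] [Module F N] [Module F[X] N] [IsScalarTower F F[X] N] [Module.Finite F N]

variable (F M) in
/-- The characteristic polynomial of multiplication by `X` on a finite-dimensional
`F[X]`-module. -/
noncomputable def charpolyX : F[X] := (Algebra.lsmul F F M (X : F[X])).charpoly

theorem charpolyX_congr (e : M ≃ₗ[F[X]] N) : charpolyX F M = charpolyX F N := by
  rw [charpolyX, ← LinearEquiv.charpoly_conj (e.restrictScalars F), charpolyX]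
  congr 1
  ext x
  simp [LinearEquiv.conj_apply]

theorem charpolyX_prod : charpolyX F (M × N) = charpolyX F M * charpolyX F N := by
  rw [charpolyX, charpolyX, charpolyX, ← LinearMap.charpoly_prodMap]
  rfl

theorem natDegree_charpolyX : (charpolyX F M).natDegree = Module.finrank F M :=
  LinearMap.charpoly_natDegree _

theorem exists_smul_eq_zero_of_irreducible_dvd_charpolyX {p : F[X]} (hp : Irreducible p)
    (h : p ∣ charpolyX F M) : ∃ x : M, x ≠ 0 ∧ p • x = 0 := by
  obtain ⟨q, hq⟩ := hp.dvd_minpoly_of_dvd_charpoly _ h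
  by_contra! hinj
  set f := Algebra.lsmul F F M (X : F[X])
  have hm : minpoly F f ≠ 0 := minpoly.ne_zero (Algebra.IsIntegral.isIntegral f)
  have hz : Polynomial.aeval f q = 0 := by
    ext x
    by_contra hx
    refine hinj _ hx ?_
    rw [← aeval_lsmul_X p, ← Module.End.mul_apply, ← map_mul, ← hq, minpoly.aeval,
      LinearMap.zero_apply]
  have hdvd := minpoly.dvd _ _ hz
  rw [hq] at hdvd hm
  exact hp.not_isUnit <| isUnit_of_dvd_one <|
    (mul_dvd_mul_iff_right (right_ne_zero_of_mul hm)).mp (by rwa [one_mul])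

end

theorem nonempty_linearEquiv_of_charpolyX_eq {F : Type*} [Field F] {M N : Type*}
    [AddCommGroup M] [Module F M] [Module F[X] M] [IsScalarTower F F[X] M] [Module.Finite F M]
    [IsSemisimpleModule F[X] M]
    [AddCommGroup N] [Module F N] [Module F[X] N] [IsScalarTower F F[X] N] [Module.Finite F N]
    [IsSemisimpleModule F[X] N]
    (h : charpolyX F M = charpolyX F N) : Nonempty (M ≃ₗ[F[X]] N) := by
  induction hd : Module.finrank F M using Nat.strong_induction_on generalizing M N with
  | _ d ih =>
  have hMN : Module.finrank F M = Module.finrank F N := by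
    rw [← natDegree_charpolyX, h, natDegree_charpolyX]
  rcases Nat.eq_zero_or_pos d with rfl | hpos
  · have := Module.finrank_zero_iff.mp hd
    have := Module.finrank_zero_iff.mp (hMN.symm.trans hd)
    exact ⟨0⟩
  obtain ⟨p, hp, hpM⟩ := exists_irreducible_of_natDegree_pos (f := charpolyX F M)
    (by rwa [natDegree_charpolyX, hd])
  obtain ⟨x, hx, hpx⟩ := exists_smul_eq_zero_of_irreducible_dvd_charpolyX hp hpM
  obtain ⟨y, hy, hpy⟩ := exists_smul_eq_zero_of_irreducible_dvd_charpolyX hp (h ▸ hpM)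
  let e : (F[X] ∙ x) ≃ₗ[F[X]] (F[X] ∙ y) :=
    (Ideal.quotTorsionOfEquivSpanSingleton F[X] M x).symm ≪≫ₗ
      Submodule.quotEquivOfEq _ _ ((torsionOf_eq_span_of_irreducible hp hx hpx).trans
        (torsionOf_eq_span_of_irreducible hp hy hpy).symm) ≪≫ₗ
      Ideal.quotTorsionOfEquivSpanSingleton F[X] N y
  obtain ⟨C, hC⟩ := exists_isCompl (F[X] ∙ x)
  obtain ⟨D, hD⟩ := exists_isCompl (F[X] ∙ y)
  have eM := Submodule.prodEquivOfIsCompl _ _ hC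
  have eN := Submodule.prodEquivOfIsCompl _ _ hD
  have : Module.Finite F C := inferInstanceAs (Module.Finite F (C.restrictScalars F))
  have : Module.Finite F D := inferInstanceAs (Module.Finite F (D.restrictScalars F))
  have : Module.Finite F (F[X] ∙ x) :=
    inferInstanceAs (Module.Finite F ((F[X] ∙ x).restrictScalars F))
  have : Module.Finite F (F[X] ∙ y) :=
    inferInstanceAs (Module.Finite F ((F[X] ∙ y).restrictScalars F))
  have hCD : charpolyX F C = charpolyX F D := by
    rw [← charpolyX_congr eM, ← charpolyX_congr eN, charpolyX_prod, charpolyX_prod,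
      charpolyX_congr e] at h
    exact mul_left_cancel₀ (LinearMap.charpoly_monic _).ne_zero h
  have hlt : Module.finrank F C < d := by
    have := (eM.restrictScalars F).finrank_eq
    rw [Module.finrank_prod, hd] at this
    have : Nontrivial (F[X] ∙ x) := by
      rwa [Submodule.nontrivial_iff_ne_bot, Ne, Submodule.span_singleton_eq_bot]
    have : 0 < Module.finrank F (F[X] ∙ x) := Module.finrank_pos
    omega
  obtain ⟨e'⟩ := ih _ hlt hCD rfl
  exact ⟨eM.symm ≪≫ₗ e.prodCongr e' ≪≫ₗ eN⟩

theorem Module.End.IsSemisimple.exists_conj_of_charpoly_eq {F V : Type*} [Field F]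
    [AddCommGroup V] [Module F V] [FiniteDimensional F V] {f g : Module.End F V}
    (hf : f.IsSemisimple) (hg : g.IsSemisimple) (h : f.charpoly = g.charpoly) :
    ∃ e : V ≃ₗ[F] V, e.conj f = g := by
  have hX (φ : Module.End F V) : charpolyX F (Module.AEval' φ) = φ.charpoly := by
    rw [charpolyX, ← LinearEquiv.charpoly_conj (Module.AEval'.of φ) φ]
    congr 1
    ext x
    obtain ⟨x, rfl⟩ := (Module.AEval'.of φ).surjective x
    simp [LinearEquiv.conj_apply, Module.AEval'.X_smul_of]
  have : IsSemisimpleModule F[X] (Module.AEval' f) := hf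
  have : IsSemisimpleModule F[X] (Module.AEval' g) := hg
  obtain ⟨e⟩ := nonempty_linearEquiv_of_charpolyX_eq (F := F) (M := Module.AEval' f)
    (N := Module.AEval' g) (by rw [hX, hX, h])
  let e' : V ≃ₗ[F] V :=
    Module.AEval'.of f ≪≫ₗ e.restrictScalars F ≪≫ₗ (Module.AEval'.of g).symm
  refine ⟨e', ?_⟩
  ext x
  obtain ⟨x, rfl⟩ := e'.surjective x
  rw [LinearEquiv.conj_apply_apply, LinearEquiv.symm_apply_apply]
  simp only [e', LinearEquiv.trans_apply, LinearEquiv.restrictScalars_apply]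
  rw [← Module.AEval'.X_smul_of, map_smul, Module.AEval'.of_symm_X_smul]

theorem Matrix.IsSymm.isSemisimple_toLin'_ratFunc {n : Type*} [Fintype n] [DecidableEq n]
    {A : Matrix n n (RatFunc ℚ)} (hA : A.IsSymm) :
    Module.End.IsSemisimple (Matrix.toLin' A) := by
  refine Module.End.isSemisimple_of_squarefree_aeval_eq_zero hA.squarefree_minpoly_ratFunc ?_
  change Polynomial.aeval (Matrix.toLinAlgEquiv' A) _ = 0
  rw [aeval_algHom_apply, minpoly.aeval, map_zero]

/-- If two symmetric matrices over the rational function field `ℚ(μ)` have the same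
characteristic polynomial `det(tI − K) = det(tI − L)`, then they are similar over `ℚ(μ)`. -/
theorem symm_matrices_over_ratFunc_same_charpoly_implies_similar
    (n : ℕ) (K L : Matrix (Fin n) (Fin n) (RatFunc ℚ))
    (hK : K.IsSymm) (hL : L.IsSymm)
    (h : K.charpoly = L.charpoly) :
    ∃ M : Matrix (Fin n) (Fin n) (RatFunc ℚ), IsUnit M ∧ M⁻¹ * K * M = L := by
  obtain ⟨e, he⟩ := hL.isSemisimple_toLin'_ratFunc.exists_conj_of_charpoly_eq
    hK.isSemisimple_toLin'_ratFunc
    (by rw [Matrix.charpoly_toLin', Matrix.charpoly_toLin', h])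
  set M := LinearMap.toMatrix' (e : (Fin n → RatFunc ℚ) →ₗ[RatFunc ℚ] (Fin n → RatFunc ℚ))
  have hM : IsUnit M := by
    refine .of_mul_eq_one (LinearMap.toMatrix' (e.symm : (Fin n → RatFunc ℚ) →ₗ[RatFunc ℚ] _)) ?_
    rw [← LinearMap.toMatrix'_comp, LinearEquiv.comp_symm, LinearMap.toMatrix'_id]
  refine ⟨M, hM, ?_⟩
  have hKM : K * M = M * L := by
    apply Matrix.toLin'.injective
    rw [Matrix.toLin'_mul, Matrix.toLin'_mul, Matrix.toLin'_toMatrix', ← he]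
    ext x
    simp [LinearEquiv.conj_apply]
  rw [mul_assoc, hKM, ← mul_assoc,
    Matrix.nonsing_inv_mul _ ((Matrix.isUnit_iff_isUnit_det _).mp hM), one_mul]
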